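/- There exists a finite constant c ≥ 1 such that, in every constrained composition setup, with δ = δ(w, z) and K_H = (1 + K_max · d_max)^H, one has V(p_{C_w}, p_{C_z}) ≤ c · K_H² · δ² · (1 + K_H δ)² · e^{K_H δ}. -/

import Mathlib

open Set MeasureTheory

/-- The cube `[-1,1]^n` in `ℝ^n`. -/
def cube (n : ℕ) : Set (Fin n → ℝ) := Set.univ.pi fun _ => Set.Icc (-1 : ℝ) 1

/-- Iterated composition of the layer maps: `iterComp d w k = w_k ∘ ⋯ ∘ w_1` in the paper's
1-indexed notation (0-indexed layers `h = 0, …, H-1` here). -/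
def iterComp (d : ℕ → ℕ) (w : ∀ h : ℕ, (Fin (d h) → ℝ) → (Fin (d (h + 1)) → ℝ)) :
    ∀ k : ℕ, (Fin (d 0) → ℝ) → (Fin (d k) → ℝ)
  | 0 => fun t => t
  | k + 1 => fun t => w k (iterComp d w k t)

/-- The density `p_F(t) = e^{F(t)} / ∫_{[-1,1]^n} e^{F(s)} ds` induced by `F` on `[-1,1]^n`. -/
noncomputable def pdens (n : ℕ) (F : (Fin n → ℝ) → ℝ) (t : Fin n → ℝ) : ℝ :=
  Real.exp (F t) / ∫ s in cube n, Real.exp (F s)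

/-- The divergence `V(p,q) = ∫_{[-1,1]^n} (log(p/q))² p` between two densities. -/
noncomputable def vDiv (n : ℕ) (p q : (Fin n → ℝ) → ℝ) : ℝ :=
  ∫ t in cube n, (Real.log (p t / q t)) ^ 2 * p t

theorem isCompact_cube (n : ℕ) : IsCompact (cube n) :=
  isCompact_univ_pi fun _ => isCompact_Icc

theorem convex_cube (n : ℕ) : Convex ℝ (cube n) :=
  convex_pi fun _ _ => convex_Icc _ _

theorem mem_cube_iff {n : ℕ} {t : Fin n → ℝ} : t ∈ cube n ↔ ∀ i, |t i| ≤ 1 := by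
  simp only [cube, Set.mem_univ_pi, Set.mem_Icc, abs_le]

theorem zero_mem_cube (n : ℕ) : (0 : Fin n → ℝ) ∈ cube n :=
  mem_cube_iff.2 fun i => by simp

theorem volume_cube_pos (n : ℕ) : 0 < volume (cube n) := by
  rw [cube, volume_pi_pi]
  refine pos_iff_ne_zero.2 (Finset.prod_ne_zero_iff.2 fun i _ => ?_)
  rw [Real.volume_Icc]
  norm_num

theorem integrableOn_exp_cube {n : ℕ} {F : (Fin n → ℝ) → ℝ} (hF : ContinuousOn F (cube n)) :
    IntegrableOn (fun t => Real.exp (F t)) (cube n) :=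
  (Real.continuous_exp.comp_continuousOn hF).integrableOn_compact (isCompact_cube n)

theorem integral_exp_cube_pos {n : ℕ} {F : (Fin n → ℝ) → ℝ} (hF : ContinuousOn F (cube n)) :
    0 < ∫ s in cube n, Real.exp (F s) := by
  have : NeZero (volume.restrict (cube n)) :=
    ⟨by simpa [Measure.restrict_eq_zero] using (volume_cube_pos n).ne'⟩
  exact integral_exp_pos (integrableOn_exp_cube hF)

theorem integral_exp_cube_le {n : ℕ} {F G : (Fin n → ℝ) → ℝ} {B : ℝ}
    (hF : ContinuousOn F (cube n)) (hG : ContinuousOn G (cube n))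
    (h : ∀ t ∈ cube n, F t ≤ B + G t) :
    Real.log (∫ s in cube n, Real.exp (F s)) ≤ B + Real.log (∫ s in cube n, Real.exp (G s)) := by
  have hle : ∫ s in cube n, Real.exp (F s) ≤ Real.exp B * ∫ s in cube n, Real.exp (G s) := by
    rw [← integral_const_mul]
    refine setIntegral_mono_on (integrableOn_exp_cube hF)
      ((integrableOn_exp_cube hG).const_mul _) (isCompact_cube n).measurableSet fun t ht => ?_
    rw [← Real.exp_add]
    exact Real.exp_le_exp.2 (h t ht)
  have hlog := Real.log_le_log (integral_exp_cube_pos hF) hle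
  rwa [Real.log_mul (Real.exp_pos B).ne' (integral_exp_cube_pos hG).ne', Real.log_exp] at hlog

/-- Uniformly close exponents induce densities that are close in the divergence `vDiv`. -/
theorem vDiv_pdens_le {n : ℕ} {F G : (Fin n → ℝ) → ℝ} {B : ℝ}
    (hF : ContinuousOn F (cube n)) (hG : ContinuousOn G (cube n))
    (h : ∀ t ∈ cube n, |F t - G t| ≤ B) :
    vDiv n (pdens n F) (pdens n G) ≤ 4 * B ^ 2 := by
  have hZF := integral_exp_cube_pos hF
  have hZG := integral_exp_cube_pos hG
  have hFG := integral_exp_cube_le (B := B) hF hG fun t ht => by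
    linarith [(abs_le.1 (h t ht)).2]
  have hGF := integral_exp_cube_le (B := B) hG hF fun t ht => by
    linarith [(abs_le.1 (h t ht)).1]
  have hp : ∀ t, 0 ≤ pdens n F t := fun t => (div_pos (Real.exp_pos _) hZF).le
  have hone : ∫ t in cube n, pdens n F t = 1 := by
    simp only [pdens, integral_div]
    exact div_self hZF.ne'
  have hint : IntegrableOn (pdens n F) (cube n) := (integrableOn_exp_cube hF).div_const _
  calc vDiv n (pdens n F) (pdens n G) ≤ ∫ t in cube n, 4 * B ^ 2 * pdens n F t := by
        refine integral_mono_of_nonneg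
          (Filter.Eventually.of_forall fun t => mul_nonneg (sq_nonneg _) (hp t))
          (hint.const_mul _) ?_
        filter_upwards [ae_restrict_mem (isCompact_cube n).measurableSet] with t ht
        refine mul_le_mul_of_nonneg_right ?_ (hp t)
        have hlog : Real.log (pdens n F t / pdens n G t) = F t - G t
            - (Real.log (∫ s in cube n, Real.exp (F s))
              - Real.log (∫ s in cube n, Real.exp (G s))) := by
          rw [pdens, pdens, Real.log_div (div_pos (Real.exp_pos _) hZF).ne'
            (div_pos (Real.exp_pos _) hZG).ne', Real.log_div (Real.exp_pos _).ne' hZF.ne',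
            Real.log_div (Real.exp_pos _).ne' hZG.ne', Real.log_exp, Real.log_exp]
          ring
        have hb := abs_le.1 (h t ht)
        calc Real.log (pdens n F t / pdens n G t) ^ 2 ≤ (2 * B) ^ 2 := by
              rw [hlog]
              exact sq_le_sq' (by linarith) (by linarith)
          _ = 4 * B ^ 2 := by ring
    _ = 4 * B ^ 2 := by rw [integral_const_mul, hone, mul_one]

/-- On `ℝ^n` with the sup norm, a functional with coordinates bounded by `K` has norm at most
`n K`. -/
theorem norm_le_of_abs_apply_single_le {n : ℕ} {K : ℝ} (hK : 0 ≤ K) (L : (Fin n → ℝ) →L[ℝ] ℝ)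
    (hL : ∀ j, |L (Pi.single j 1)| ≤ K) : ‖L‖ ≤ K * n := by
  refine L.opNorm_le_bound (by positivity) fun x => ?_
  have hx : L x = ∑ j, x j * L (Pi.single j 1) := by
    conv_lhs => rw [pi_eq_sum_univ' x]
    simp [map_sum]
  calc ‖L x‖ ≤ ∑ j : Fin n, ‖x‖ * K := by
        rw [hx]
        refine (norm_sum_le _ _).trans (Finset.sum_le_sum fun j _ => ?_)
        rw [norm_mul]
        exact mul_le_mul (norm_le_pi_norm x j) (hL j) (norm_nonneg _) (norm_nonneg _)
    _ = K * n * ‖x‖ := by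
        simp
        ring

theorem abs_sub_le_of_abs_partial_le {n : ℕ} {K e : ℝ} (hK : 0 ≤ K) {f : (Fin n → ℝ) → ℝ}
    (hf : ContDiffOn ℝ 1 f (cube n))
    (hd : ∀ j, ∀ t ∈ cube n, |fderivWithin ℝ f (cube n) t (Pi.single j 1)| ≤ K)
    {x y : Fin n → ℝ} (hx : x ∈ cube n) (hy : y ∈ cube n) (he : 0 ≤ e)
    (hxy : ∀ j, |x j - y j| ≤ e) : |f x - f y| ≤ K * n * e := by
  refine ((convex_cube n).norm_image_sub_le_of_norm_fderivWithin_le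
    (hf.differentiableOn one_ne_zero)
    (fun t ht => norm_le_of_abs_apply_single_le hK _ fun j => hd j t ht) hy hx).trans ?_
  exact mul_le_mul_of_nonneg_left ((pi_norm_le_iff_of_nonneg he).2 hxy) (by positivity)

section iterComp

variable {d : ℕ → ℕ} {H : ℕ} {w z : ∀ h : ℕ, (Fin (d h) → ℝ) → (Fin (d (h + 1)) → ℝ)}

theorem iterComp_mem_cube (hw : ∀ h, h + 1 < H → ∀ i, ∀ t ∈ cube (d h), |w h t i| ≤ 1)
    {t : Fin (d 0) → ℝ} (ht : t ∈ cube (d 0)) {k : ℕ} (hk : k < H) :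
    iterComp d w k t ∈ cube (d k) := by
  induction k with
  | zero => exact ht
  | succ k ih => exact mem_cube_iff.2 fun i => hw k hk i _ (ih (by omega))

theorem continuousOn_iterComp (hw : ∀ h, h + 1 < H → ∀ i, ∀ t ∈ cube (d h), |w h t i| ≤ 1)
    (hc : ∀ h, h < H → ∀ i, ContinuousOn (fun t => w h t i) (cube (d h))) {k : ℕ} (hk : k ≤ H) :
    ContinuousOn (iterComp d w k) (cube (d 0)) := by
  induction k with
  | zero => exact continuousOn_id
  | succ k ih =>
    exact (continuousOn_pi.2 (hc k hk)).comp (ih (by omega))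
      fun t ht => iterComp_mem_cube hw ht hk

theorem abs_iterComp_sub_le {dmax : ℕ} (hdmax : ∀ h, h < H → d h ≤ dmax) {K δ : ℝ} (hK : 0 ≤ K)
    (hδ : 0 ≤ δ) (hw : ∀ h, h + 1 < H → ∀ i, ∀ t ∈ cube (d h), |w h t i| ≤ 1)
    (hz : ∀ h, h + 1 < H → ∀ i, ∀ t ∈ cube (d h), |z h t i| ≤ 1)
    (hdiff : ∀ h, 1 ≤ h → h < H → ∀ i, ContDiffOn ℝ 1 (fun t => w h t i) (cube (d h)))
    (hderiv : ∀ h, 1 ≤ h → h < H → ∀ i j, ∀ t ∈ cube (d h),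
      |fderivWithin ℝ (fun s => w h s i) (cube (d h)) t (Pi.single j 1)| ≤ K)
    (hwz : ∀ h, h < H → ∀ i, ∀ t ∈ cube (d h), |w h t i - z h t i| ≤ δ)
    {t : Fin (d 0) → ℝ} (ht : t ∈ cube (d 0)) {k : ℕ} (hk : k ≤ H) (i : Fin (d k)) :
    |iterComp d w k t i - iterComp d z k t i| ≤ (1 + K * dmax) ^ k * δ := by
  induction k with
  | zero => simpa [iterComp] using hδ
  | succ k ih =>
    have hKd : 0 ≤ K * dmax := by positivity
    have hpow : 1 ≤ (1 + K * dmax) ^ k := one_le_pow₀ (by linarith)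
    have hzk := iterComp_mem_cube hz ht hk
    have hlip : |w k (iterComp d w k t) i - w k (iterComp d z k t) i| ≤
        K * dmax * ((1 + K * dmax) ^ k * δ) := by
      rcases Nat.eq_zero_or_pos k with rfl | hpos
      · simp only [iterComp, sub_self, abs_zero]
        positivity
      · refine (abs_sub_le_of_abs_partial_le hK (hdiff k hpos hk i) (hderiv k hpos hk i)
          (iterComp_mem_cube hw ht hk) hzk (by positivity) (ih (by omega))).trans ?_
        have hdk : (d k : ℝ) ≤ dmax := by exact_mod_cast hdmax k hk
        gcongr
    calc |iterComp d w (k + 1) t i - iterComp d z (k + 1) t i|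
        ≤ K * dmax * ((1 + K * dmax) ^ k * δ) + δ :=
          (abs_sub_le _ (w k (iterComp d z k t) i) _).trans
            (add_le_add hlip (hwz k hk i _ hzk))
      _ ≤ K * dmax * ((1 + K * dmax) ^ k * δ) + (1 + K * dmax) ^ k * δ := by
          gcongr
          exact le_mul_of_one_le_left hδ hpow
      _ = (1 + K * dmax) ^ (k + 1) * δ := by ring

end iterComp

/-- there is a universal finite constant `c ≥ 1` such that in every constrained
composition setup, `V(p_{C_w}, p_{C_z}) ≤ c K_H² δ² (1 + K_H δ)² e^{K_H δ}` with
`K_H = (1 + K_max d_max)^H` and `δ = δ(w,z)`. -/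
theorem stmt7 :
    ∃ c : ℝ, 1 ≤ c ∧
      ∀ (H : ℕ), 2 ≤ H →
      ∀ d : ℕ → ℕ, (∀ h, h ≤ H → 0 < d h) → d H = 1 →
      ∀ dmax : ℕ, (∀ h, h < H → d h ≤ dmax) →
      ∀ Kmax : ℝ, 0 < Kmax →
      ∀ w z : ∀ h : ℕ, (Fin (d h) → ℝ) → (Fin (d (h + 1)) → ℝ),
      (∀ h, h < H → ∀ i, ContinuousOn (fun t => w h t i) (cube (d h))) →
      (∀ h, h < H → ∀ i, ContinuousOn (fun t => z h t i) (cube (d h))) →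
      (∀ h, h + 1 < H → ∀ i, ∀ t ∈ cube (d h), |w h t i| ≤ 1) →
      (∀ h, h + 1 < H → ∀ i, ∀ t ∈ cube (d h), |z h t i| ≤ 1) →
      (∀ h, 1 ≤ h → h < H → ∀ i, ContDiffOn ℝ 1 (fun t => w h t i) (cube (d h))) →
      (∀ h, 1 ≤ h → h < H → ∀ i, ContDiffOn ℝ 1 (fun t => z h t i) (cube (d h))) →
      (∀ h, 1 ≤ h → h < H → ∀ i j, ∀ t ∈ cube (d h),
        |fderivWithin ℝ (fun s => w h s i) (cube (d h)) t (Pi.single j 1)| ≤ Kmax) →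
      (∀ h, 1 ≤ h → h < H → ∀ i j, ∀ t ∈ cube (d h),
        |fderivWithin ℝ (fun s => z h s i) (cube (d h)) t (Pi.single j 1)| ≤ Kmax) →
      ∀ δ : ℝ, (∀ h, h < H → ∀ i, ∀ t ∈ cube (d h), |w h t i - z h t i| ≤ δ) →
      ∀ i : Fin (d H),
        vDiv (d 0) (pdens (d 0) fun t => iterComp d w H t i)
            (pdens (d 0) fun t => iterComp d z H t i)
          ≤ c * ((1 + Kmax * dmax) ^ H) ^ 2 * δ ^ 2 * (1 + (1 + Kmax * dmax) ^ H * δ) ^ 2 *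
            Real.exp ((1 + Kmax * dmax) ^ H * δ) := by
  refine ⟨4, by norm_num, ?_⟩
  intro H hH d hd _ dmax hdmax Kmax hK w z hwc hzc hw hz hwd _ hwK _ δ hδ i
  have hδ0 : 0 ≤ δ := (abs_nonneg _).trans
    (hδ 0 (by omega) ⟨0, hd 1 (by omega)⟩ 0 (zero_mem_cube _))
  set M : ℝ := (1 + Kmax * dmax) ^ H with hM
  have hM0 : 0 ≤ M := by positivity
  have hMδ : 0 ≤ M * δ := mul_nonneg hM0 hδ0
  calc _ ≤ 4 * (M * δ) ^ 2 :=
        vDiv_pdens_le (continuousOn_pi.1 (continuousOn_iterComp hw hwc le_rfl) i)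
          (continuousOn_pi.1 (continuousOn_iterComp hz hzc le_rfl) i) fun t ht =>
          abs_iterComp_sub_le hdmax hK.le hδ0 hw hz hwd hwK hδ ht le_rfl i
    _ = 4 * M ^ 2 * δ ^ 2 * 1 * 1 := by ring
    _ ≤ 4 * M ^ 2 * δ ^ 2 * (1 + M * δ) ^ 2 * Real.exp (M * δ) := by
        gcongr
        · exact one_le_pow₀ (by linarith)
        · exact Real.one_le_exp hMδ
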